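/- arXiv:2303.08217 — 8 statements merged into one kernel-verified Lean document; each statement's English description precedes it below -/
import Mathlib

section
/- Let ρ : C → [0,1] be a default risk measure and F : B_b → ℝ be monotone (F(X) ≤ F(Y) whenever X ≤ Y pointwise) and compatible with ρ (i.e., F(0) = 0 and, for all X, Y ∈ C, F(X − Y) ≤ 0 implies ρ(X) ≤ ρ(Y)). Then the map ρ_F : B_b → ℝ defined by ρ_F(X) := inf{ ρ(X₀) | X₀ ∈ C, F(X − X₀) ≤ 0 } is a default risk measure on B_b satisfying ρ_F(X) = ρ(X) for all X ∈ C. -/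
open MeasureTheory Filter Topology

/-- The set of bounded measurable functions `Ω → ℝ`. -/
def Bb (Ω : Type*) [MeasurableSpace Ω] : Set (Ω → ℝ) :=
  {X | Measurable X ∧ ∃ M : ℝ, ∀ ω, |X ω| ≤ M}

/-- A default risk measure on a set `C` of bounded measurable functions:
it takes values in `[0,1]` on `C`, is monotone on `C`, vanishes at `0`,
and equals `1` on positive constants. -/
def IsDefaultRiskMeasure {Ω : Type*} [MeasurableSpace Ω]
    (C : Set (Ω → ℝ)) (ρ : (Ω → ℝ) → ℝ) : Prop :=
  (∀ X ∈ C, ρ X ∈ Set.Icc (0 : ℝ) 1) ∧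
  (∀ X ∈ C, ∀ Y ∈ C, (∀ ω, X ω ≤ Y ω) → ρ X ≤ ρ Y) ∧
  ρ (fun _ => 0) = 0 ∧
  (∀ m : ℝ, 0 < m → ρ (fun _ => m) = 1)

/-- A monetary risk measure on `Bb Ω`: monotone, normalized, cash additive. -/
def IsMonetaryRiskMeasure {Ω : Type*} [MeasurableSpace Ω] (R : (Ω → ℝ) → ℝ) : Prop :=
  (∀ X ∈ Bb Ω, ∀ Y ∈ Bb Ω, (∀ ω, X ω ≤ Y ω) → R X ≤ R Y) ∧
  R (fun _ => 0) = 0 ∧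
  (∀ X ∈ Bb Ω, ∀ m : ℝ, R (fun ω => X ω + m) = R X + m)

/-- The `ρ`-value at risk at level `α`. -/
noncomputable def VaR {Ω : Type*} [MeasurableSpace Ω]
    (ρ : (Ω → ℝ) → ℝ) (α : ℝ) (X : Ω → ℝ) : ℝ :=
  sInf {m : ℝ | ρ (fun ω => X ω - m) ≤ α}

theorem sub_mem_Bb {Ω : Type*} [MeasurableSpace Ω] {X Y : Ω → ℝ}
    (hX : X ∈ Bb Ω) (hY : Y ∈ Bb Ω) : X - Y ∈ Bb Ω := by
  obtain ⟨hX, M, hM⟩ := hX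
  obtain ⟨hY, N, hN⟩ := hY
  exact ⟨hX.sub hY, M + N, fun ω => (abs_sub _ _).trans (add_le_add (hM ω) (hN ω))⟩

/-- extension of a default risk measure from `C` to `Bb Ω` via a
monotone compatible functional `F`. -/
theorem extension_default_risk_measure {Ω : Type*} [MeasurableSpace Ω]
    (C : Set (Ω → ℝ)) (hC : C ⊆ Bb Ω)
    (hconst : ∀ m : ℝ, (fun _ => m) ∈ C)
    (ρ F : (Ω → ℝ) → ℝ)
    (hρ : IsDefaultRiskMeasure C ρ)
    (hFmono : ∀ X ∈ Bb Ω, ∀ Y ∈ Bb Ω, (∀ ω, X ω ≤ Y ω) → F X ≤ F Y)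
    (hF0 : F (fun _ => 0) = 0)
    (hcompat : ∀ X ∈ C, ∀ Y ∈ C, F (X - Y) ≤ 0 → ρ X ≤ ρ Y) :
    IsDefaultRiskMeasure (Bb Ω)
      (fun X => sInf (ρ '' {X₀ ∈ C | F (X - X₀) ≤ 0})) ∧
    ∀ X ∈ C, sInf (ρ '' {X₀ ∈ C | F (X - X₀) ≤ 0}) = ρ X := by
  obtain ⟨hρ01, hρmono, hρ0, hρ1⟩ := hρ
  have hbdd : ∀ X : Ω → ℝ, BddBelow (ρ '' {X₀ ∈ C | F (X - X₀) ≤ 0}) := by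
    rintro X
    refine ⟨0, ?_⟩
    rintro _ ⟨Y, hY, rfl⟩
    exact (hρ01 Y hY.1).1
  have hext : ∀ X ∈ C, sInf (ρ '' {X₀ ∈ C | F (X - X₀) ≤ 0}) = ρ X := by
    intro X hX
    have hXX : X ∈ {X₀ ∈ C | F (X - X₀) ≤ 0} := by
      refine ⟨hX, ?_⟩
      rw [sub_self]
      exact hF0.le
    refine le_antisymm (csInf_le (hbdd X) ⟨X, hXX, rfl⟩) (le_csInf ⟨_, X, hXX, rfl⟩ ?_)
    rintro _ ⟨Y, hY, rfl⟩
    exact hcompat X hX Y hY.1 hY.2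
  have hne : ∀ X ∈ Bb Ω, ∃ M : ℝ, (fun _ => M) ∈ {X₀ ∈ C | F (X - X₀) ≤ 0} := by
    intro X hX
    obtain ⟨M, hM⟩ := hX.2
    refine ⟨M, hconst M, ?_⟩
    rw [← hF0]
    exact hFmono _ (sub_mem_Bb hX (hC (hconst M))) _ (hC (hconst 0))
      fun ω => sub_nonpos.2 ((le_abs_self _).trans (hM ω))
  refine ⟨⟨?_, ?_, ?_, ?_⟩, hext⟩
  · intro X hX
    obtain ⟨M, hM⟩ := hne X hX
    refine ⟨le_csInf ⟨_, _, hM, rfl⟩ ?_,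
      (csInf_le (hbdd X) ⟨_, hM, rfl⟩).trans (hρ01 _ hM.1).2⟩
    rintro _ ⟨Y, hY, rfl⟩
    exact (hρ01 Y hY.1).1
  · intro X hX Y hY hXY
    obtain ⟨M, hM⟩ := hne Y hY
    refine csInf_le_csInf (hbdd X) ⟨_, _, hM, rfl⟩ (Set.image_mono ?_)
    rintro Z ⟨hZ, hFZ⟩
    exact ⟨hZ, (hFmono _ (sub_mem_Bb hX (hC hZ)) _ (sub_mem_Bb hY (hC hZ))
      fun ω => sub_le_sub_right (hXY ω) _).trans hFZ⟩
  · exact (hext _ (hconst 0)).trans hρ0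
  · exact fun m hm => (hext _ (hconst m)).trans (hρ1 m hm)
end

section
/- Let (R^α)_{α∈(0,1)} be a generalized quantile function and define ρ(X) := inf( { α ∈ (0,1) | R^α(X) ≤ 0 } ∪ {1} ) for X ∈ B_b. Then ρ : B_b → [0,1] is a default risk measure and R^α = VaR_ρ^α for all α ∈ (0,1). -/
open MeasureTheory Filter Topology

lemma const_mem_Bb {Ω : Type*} [MeasurableSpace Ω] (c : ℝ) : (fun _ => c) ∈ Bb Ω :=
  ⟨measurable_const, |c|, fun _ => le_rfl⟩

lemma add_const_mem_Bb {Ω : Type*} [MeasurableSpace Ω] {X : Ω → ℝ} (hX : X ∈ Bb Ω) (c : ℝ) :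
    (fun ω => X ω + c) ∈ Bb Ω := by
  obtain ⟨hm, M, hM⟩ := hX
  exact ⟨hm.add_const c, M + |c|, fun ω => (abs_add_le _ _).trans (by gcongr; exact hM ω)⟩

lemma IsMonetaryRiskMeasure.apply_const {Ω : Type*} [MeasurableSpace Ω] {R : (Ω → ℝ) → ℝ}
    (hR : IsMonetaryRiskMeasure R) (m : ℝ) : R (fun _ => m) = m := by
  simpa [hR.2.1] using hR.2.2 _ (const_mem_Bb 0) m

lemma bddBelow_acceptable_levels (f : ℝ → ℝ) :
    BddBelow ({α ∈ Set.Ioo (0 : ℝ) 1 | f α ≤ 0} ∪ {1}) := by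
  refine ⟨0, ?_⟩
  rintro a (ha | rfl)
  exacts [ha.1.1.le, zero_le_one]

/-- For an antitone family that is the supremum of its values to the right, the infimum of the
acceptable levels is at most `α` exactly when `α` itself is acceptable. -/
lemma sInf_acceptable_levels_le_iff {f : ℝ → ℝ}
    (hanti : ∀ α ∈ Set.Ioo (0 : ℝ) 1, ∀ β ∈ Set.Ioo (0 : ℝ) 1, α ≤ β → f β ≤ f α)
    {α : ℝ} (hα : α ∈ Set.Ioo (0 : ℝ) 1) (hsup : f α = sSup (f '' Set.Ioo α 1)) :
    sInf ({β ∈ Set.Ioo (0 : ℝ) 1 | f β ≤ 0} ∪ {1}) ≤ α ↔ f α ≤ 0 := by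
  constructor
  · intro h
    rw [hsup]
    refine csSup_le ((Set.nonempty_Ioo.2 hα.2).image f) ?_
    rintro _ ⟨β, hβ, rfl⟩
    obtain ⟨γ, hγ | rfl, hlt⟩ :=
      exists_lt_of_csInf_lt (Set.singleton_nonempty (1 : ℝ)).inr (h.trans_lt hβ.1)
    · exact (hanti γ hγ.1 β ⟨hα.1.trans hβ.1, hβ.2⟩ hlt.le).trans hγ.2
    · exact absurd hβ.2 hlt.not_gt
  · exact fun h => csInf_le (bddBelow_acceptable_levels f) (Or.inl ⟨hα, h⟩)

/-- the default risk measure induced by a generalized quantile function,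
whose `ρ`-value at risk recovers the family. -/
theorem generalized_quantile_induces_DRM {Ω : Type*} [MeasurableSpace Ω]
    (R : ℝ → (Ω → ℝ) → ℝ)
    (h1 : ∀ α ∈ Set.Ioo (0 : ℝ) 1, IsMonetaryRiskMeasure (R α))
    (h2 : ∀ X ∈ Bb Ω, ∀ α ∈ Set.Ioo (0 : ℝ) 1, ∀ β ∈ Set.Ioo (0 : ℝ) 1,
        α ≤ β → R β X ≤ R α X)
    (h3 : ∀ α ∈ Set.Ioo (0 : ℝ) 1, ∀ X ∈ Bb Ω,
        R α X = sSup ((fun β => R β X) '' Set.Ioo α 1)) :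
    IsDefaultRiskMeasure (Bb Ω)
      (fun X => sInf ({α ∈ Set.Ioo (0 : ℝ) 1 | R α X ≤ 0} ∪ {1})) ∧
    ∀ α ∈ Set.Ioo (0 : ℝ) 1, ∀ X ∈ Bb Ω,
      R α X = VaR (fun Y => sInf ({β ∈ Set.Ioo (0 : ℝ) 1 | R β Y ≤ 0} ∪ {1})) α X := by
  refine ⟨⟨?_, ?_, ?_, ?_⟩, ?_⟩
  · intro X _
    refine ⟨le_csInf (Set.singleton_nonempty (1 : ℝ)).inr ?_,
      csInf_le (bddBelow_acceptable_levels fun α => R α X) (Or.inr rfl)⟩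
    rintro a (ha | rfl)
    exacts [ha.1.1.le, zero_le_one]
  · intro X hX Y hY hXY
    exact csInf_le_csInf (bddBelow_acceptable_levels fun α => R α X)
      (Set.singleton_nonempty (1 : ℝ)).inr
      (Set.union_subset_union_left _ fun α hα =>
        ⟨hα.1, ((h1 α hα.1).1 X hX Y hY hXY).trans hα.2⟩)
  · have hset : {α ∈ Set.Ioo (0 : ℝ) 1 | R α (fun _ => 0) ≤ 0} ∪ {1} = Set.Ioc 0 1 := by
      rw [← Set.Ioo_union_right zero_lt_one]
      congr 1
      exact Set.sep_eq_self_iff_mem_true.2 fun α hα => (h1 α hα).2.1.le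
    simp only [hset, csInf_Ioc zero_lt_one]
  · intro m hm
    have hset : {α ∈ Set.Ioo (0 : ℝ) 1 | R α (fun _ => m) ≤ 0} = ∅ :=
      Set.eq_empty_of_forall_notMem fun α hα =>
        hm.not_ge (((h1 α hα.1).apply_const m).ge.trans hα.2)
    simp only [hset, Set.empty_union, csInf_singleton]
  · intro α hα X hX
    have hset : {m : ℝ | sInf ({β ∈ Set.Ioo (0 : ℝ) 1 | R β (fun ω => X ω - m) ≤ 0} ∪ {1}) ≤ α}
        = Set.Ici (R α X) := by
      ext m
      have hXm : (fun ω => X ω - m) ∈ Bb Ω := by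
        simpa only [sub_eq_add_neg] using add_const_mem_Bb hX (-m)
      have hcash : R α (fun ω => X ω - m) = R α X - m := by
        simpa only [sub_eq_add_neg] using (h1 α hα).2.2 X hX (-m)
      rw [Set.mem_ofPred_eq, sInf_acceptable_levels_le_iff (f := fun β => R β fun ω => X ω - m)
        (h2 _ hXm) hα (h3 α hα _ hXm), hcash, sub_nonpos, Set.mem_Ici]
    simp only [VaR, hset, csInf_Ici]
end

section
/- Let ρ : B_b → [0,1] be a scaling invariant default risk measure. Then for all X ∈ B_b with X ≥ 0 pointwise: (a) ρ(X) ≤ ρ(𝟙_{X>0}) ≤ inf_{ε>0} ρ(X + ε·𝟙_{X>0}), and (b) sup_{ε>0} ρ(𝟙_{X>ε}) ≤ ρ(X) ≤ ρ(𝟙_{X>0}). -/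
open MeasureTheory Filter Topology

/-- The indicator function of the default set `{X > 0}`. -/
noncomputable def indPos {Ω : Type*} (X : Ω → ℝ) : Ω → ℝ :=
  Set.indicator {ω | 0 < X ω} (fun _ => 1)

/-- Scaling a bounded measurable function keeps it bounded and measurable. -/
lemma const_mul_mem_Bb {Ω : Type*} [MeasurableSpace Ω] {X : Ω → ℝ} (hX : X ∈ Bb Ω) (l : ℝ) :
    (fun ω => l * X ω) ∈ Bb Ω := by
  obtain ⟨hm, M, hM⟩ := hX
  refine ⟨hm.const_mul l, |l| * M, fun ω => ?_⟩
  rw [abs_mul]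
  exact mul_le_mul_of_nonneg_left (hM ω) (abs_nonneg l)

lemma add_mem_Bb {Ω : Type*} [MeasurableSpace Ω] {X Y : Ω → ℝ} (hX : X ∈ Bb Ω)
    (hY : Y ∈ Bb Ω) : (fun ω => X ω + Y ω) ∈ Bb Ω := by
  obtain ⟨hXm, M, hM⟩ := hX
  obtain ⟨hYm, N, hN⟩ := hY
  exact ⟨hXm.add hYm, M + N, fun ω => (abs_add_le _ _).trans (add_le_add (hM ω) (hN ω))⟩

lemma indicator_one_mem_Bb {Ω : Type*} [MeasurableSpace Ω] {A : Set Ω} (hA : MeasurableSet A) :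
    A.indicator (fun _ => (1 : ℝ)) ∈ Bb Ω := by
  refine ⟨measurable_const.indicator hA, 1, fun ω => ?_⟩
  by_cases h : ω ∈ A <;> simp [h]

/-- A scaling invariant monotone functional is monotone up to positive multiples. -/
lemma le_of_le_const_mul {Ω : Type*} [MeasurableSpace Ω] {ρ : (Ω → ℝ) → ℝ}
    (hmono : ∀ X ∈ Bb Ω, ∀ Y ∈ Bb Ω, (∀ ω, X ω ≤ Y ω) → ρ X ≤ ρ Y)
    (hscal : ∀ l : ℝ, 0 < l → ∀ X ∈ Bb Ω, (∀ ω, 0 ≤ X ω) →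
        ρ (fun ω => l * X ω) = ρ X)
    {X Y : Ω → ℝ} (hX : X ∈ Bb Ω) (hY : Y ∈ Bb Ω) (hY0 : ∀ ω, 0 ≤ Y ω)
    {l : ℝ} (hl : 0 < l) (h : ∀ ω, X ω ≤ l * Y ω) : ρ X ≤ ρ Y :=
  (hmono X hX _ (const_mul_mem_Bb hY l) h).trans_eq (hscal l hl Y hY hY0)

/-- bounds for scaling invariant default risk measures on
nonnegative positions. -/
theorem scaling_invariant_bounds {Ω : Type*} [MeasurableSpace Ω]
    (ρ : (Ω → ℝ) → ℝ) (hρ : IsDefaultRiskMeasure (Bb Ω) ρ)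
    (hscal : ∀ l : ℝ, 0 < l → ∀ X ∈ Bb Ω, (∀ ω, 0 ≤ X ω) →
        ρ (fun ω => l * X ω) = ρ X) :
    ∀ X ∈ Bb Ω, (∀ ω, 0 ≤ X ω) →
      (ρ X ≤ ρ (indPos X) ∧
        ρ (indPos X)
          ≤ sInf ((fun ε => ρ (fun ω => X ω + ε * indPos X ω)) '' Set.Ioi 0)) ∧
      (sSup ((fun ε => ρ (Set.indicator {ω | ε < X ω} (fun _ => 1))) '' Set.Ioi 0)
          ≤ ρ X ∧ ρ X ≤ ρ (indPos X)) := by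
  intro X hX hX0
  have hmono := hρ.2.1
  have hI : indPos X ∈ Bb Ω := indicator_one_mem_Bb (measurableSet_lt measurable_const hX.1)
  have hI0 : ∀ ω, 0 ≤ indPos X ω := fun ω => Set.indicator_nonneg (fun _ _ => zero_le_one) ω
  have upper : ρ X ≤ ρ (indPos X) := by
    obtain ⟨M, hM⟩ := hX.2
    refine le_of_le_const_mul hmono hscal hX hI hI0
      (lt_max_of_lt_right one_pos : (0 : ℝ) < max M 1) fun ω => ?_
    by_cases h : 0 < X ω
    · simpa [indPos, h] using Or.inl ((le_abs_self _).trans (hM ω))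
    · simpa [indPos, h] using le_of_not_gt h
  refine ⟨⟨upper, ?_⟩, ?_, upper⟩
  · refine le_csInf (Set.nonempty_Ioi.image _) ?_
    rintro _ ⟨ε, hε : 0 < ε, rfl⟩
    have hεI : ∀ ω, 0 ≤ ε * indPos X ω := fun ω => mul_nonneg hε.le (hI0 ω)
    refine le_of_le_const_mul hmono hscal hI (add_mem_Bb hX (const_mul_mem_Bb hI ε))
      (fun ω => add_nonneg (hX0 ω) (hεI ω)) (inv_pos.2 hε) fun ω => ?_
    rw [le_inv_mul_iff₀ hε]
    exact le_add_of_nonneg_left (hX0 ω)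
  · refine csSup_le (Set.nonempty_Ioi.image _) ?_
    rintro _ ⟨ε, hε : 0 < ε, rfl⟩
    refine le_of_le_const_mul hmono hscal
      (indicator_one_mem_Bb (measurableSet_lt measurable_const hX.1)) hX hX0
      (inv_pos.2 hε) fun ω => ?_
    rw [le_inv_mul_iff₀ hε]
    by_cases h : ε < X ω
    · simpa [h] using h.le
    · simpa [h] using hX0 ω
end

section
/- Let ρ : B_b → [0,1] be a default risk measure. Then the following are equivalent: (i) ρ(X) = ρ(X⁺) for all X ∈ B_b, where X⁺ := X·𝟙_{X>0}; (ii) ρ(X) = ρ(X − m·𝟙_{X≤0}) for all m > 0 and X ∈ B_b; (iii) ρ is liquidity invariant. -/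
open MeasureTheory Filter Topology

lemma mul_indPos_eq_max {Ω : Type*} (X : Ω → ℝ) :
    (fun ω => X ω * indPos X ω) = fun ω => max (X ω) 0 := by
  funext ω
  by_cases h : 0 < X ω
  · simp [indPos, h, h.le]
  · simp [indPos, h, not_lt.mp h]

lemma max_zero_mem_Bb {Ω : Type*} [MeasurableSpace Ω] {X : Ω → ℝ} (hX : X ∈ Bb Ω) :
    (fun ω => max (X ω) 0) ∈ Bb Ω := by
  obtain ⟨hm, M, hM⟩ := hX
  exact ⟨hm.max measurable_const, M, fun ω => (abs_max_le_max_abs_abs.trans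
    (max_le (hM ω) (by simpa using (abs_nonneg _).trans (hM ω))))⟩

lemma sub_mul_indicator_mem_Bb {Ω : Type*} [MeasurableSpace Ω] {X : Ω → ℝ} (hX : X ∈ Bb Ω)
    (m : ℝ) {s : Set Ω} (hs : MeasurableSet s) :
    (fun ω => X ω - m * s.indicator (fun _ => (1 : ℝ)) ω) ∈ Bb Ω := by
  obtain ⟨hm, M, hM⟩ := hX
  refine ⟨hm.sub ((measurable_const.indicator hs).const_mul m), M + |m|, fun ω => ?_⟩
  refine (abs_sub _ _).trans (add_le_add (hM ω) ?_)
  by_cases h : ω ∈ s <;> simp [h]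

/-- for a default risk measure the following are equivalent:
(i) `ρ(X) = ρ(X⁺)` with `X⁺ = X·𝟙_{X>0}`;
(ii) `ρ(X) = ρ(X − m·𝟙_{X≤0})` for all `m > 0`;
(iii) liquidity invariance. -/
theorem liquidity_invariance_equiv {Ω : Type*} [MeasurableSpace Ω]
    (ρ : (Ω → ℝ) → ℝ) (hρ : IsDefaultRiskMeasure (Bb Ω) ρ) :
    ((∀ X ∈ Bb Ω, ρ X = ρ (fun ω => X ω * indPos X ω)) ↔
      (∀ m : ℝ, 0 < m → ∀ X ∈ Bb Ω,
          ρ X = ρ (fun ω =>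
            X ω - m * Set.indicator {ω' | X ω' ≤ 0} (fun _ => 1) ω))) ∧
    ((∀ m : ℝ, 0 < m → ∀ X ∈ Bb Ω,
          ρ X = ρ (fun ω =>
            X ω - m * Set.indicator {ω' | X ω' ≤ 0} (fun _ => 1) ω)) ↔
      (∀ m : ℝ, 0 < m → ∀ X ∈ Bb Ω, (∀ ω, 0 ≤ X ω) →
          ρ X = ρ (fun ω =>
            X ω - m * Set.indicator {ω' | X ω' = 0} (fun _ => 1) ω))) := by
  have h12 : (∀ X ∈ Bb Ω, ρ X = ρ (fun ω => X ω * indPos X ω)) →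
      (∀ m : ℝ, 0 < m → ∀ X ∈ Bb Ω,
          ρ X = ρ (fun ω =>
            X ω - m * Set.indicator {ω' | X ω' ≤ 0} (fun _ => 1) ω)) := by
    intro h m hm X hX
    have hs : MeasurableSet {ω' | X ω' ≤ 0} := measurableSet_le hX.1 measurable_const
    rw [h X hX, h _ (sub_mul_indicator_mem_Bb hX m hs), mul_indPos_eq_max, mul_indPos_eq_max]
    congr 1
    funext ω
    by_cases hω : X ω ≤ 0
    · have : X ω - m ≤ 0 := by linarith
      simp [hω, this]
    · simp [hω]
  have h23 : (∀ m : ℝ, 0 < m → ∀ X ∈ Bb Ω,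
          ρ X = ρ (fun ω =>
            X ω - m * Set.indicator {ω' | X ω' ≤ 0} (fun _ => 1) ω)) →
      (∀ m : ℝ, 0 < m → ∀ X ∈ Bb Ω, (∀ ω, 0 ≤ X ω) →
          ρ X = ρ (fun ω =>
            X ω - m * Set.indicator {ω' | X ω' = 0} (fun _ => 1) ω)) := by
    intro h m hm X hX h0
    have hs : {ω' | X ω' = 0} = {ω' | X ω' ≤ 0} := by
      ext ω
      exact (h0 ω).ge_iff_eq'.symm
    rw [hs]
    exact h m hm X hX
  have h31 : (∀ m : ℝ, 0 < m → ∀ X ∈ Bb Ω, (∀ ω, 0 ≤ X ω) →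
          ρ X = ρ (fun ω =>
            X ω - m * Set.indicator {ω' | X ω' = 0} (fun _ => 1) ω)) →
      (∀ X ∈ Bb Ω, ρ X = ρ (fun ω => X ω * indPos X ω)) := by
    intro h X hX
    obtain ⟨M, hM⟩ := hX.2
    have hP := max_zero_mem_Bb hX
    have hs : MeasurableSet {ω' | max (X ω') 0 = 0} :=
      measurableSet_eq_fun hP.1 measurable_const
    rw [mul_indPos_eq_max]
    refine le_antisymm (hρ.2.1 X hX _ hP fun ω => le_max_left _ _) ?_
    rw [h (|M| + 1) (by positivity) _ hP fun ω => le_max_right _ _]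
    refine hρ.2.1 _ (sub_mul_indicator_mem_Bb hP _ hs) X hX fun ω => ?_
    by_cases hω : X ω ≤ 0
    · have := neg_le_of_abs_le (hM ω)
      have := le_abs_self M
      simp [hω]
      linarith
    · simp [hω, (not_le.mp hω).le]
  exact ⟨⟨h12, fun h => h31 (h23 h)⟩, ⟨h23, fun h => h12 (h31 h)⟩⟩
end

section
/- Let ρ : B_b → [0,1] be a submodular default risk measure. Then ρ is illiquidity invariant if and only if ρ(X) = ρ(𝟙_{X>0}) for all X ∈ B_b. -/
open MeasureTheory Filter Topology

theorem measurable_indPos {Ω : Type*} [MeasurableSpace Ω] {X : Ω → ℝ} (hX : Measurable X) :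
    Measurable (indPos X) :=
  measurable_const.indicator (measurableSet_lt measurable_const hX)

theorem indPos_of_pos {Ω : Type*} {X : Ω → ℝ} {ω : Ω} (h : 0 < X ω) : indPos X ω = 1 :=
  Set.indicator_of_mem (s := {ω | 0 < X ω}) h _

theorem indPos_of_nonpos {Ω : Type*} {X : Ω → ℝ} {ω : Ω} (h : X ω ≤ 0) : indPos X ω = 0 :=
  Set.indicator_of_notMem (s := {ω | 0 < X ω}) h.not_gt _

theorem indPos_nonneg {Ω : Type*} (X : Ω → ℝ) (ω : Ω) : 0 ≤ indPos X ω :=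
  Set.indicator_nonneg (fun _ _ => zero_le_one) ω

theorem indPos_congr {Ω : Type*} {X Y : Ω → ℝ} (h : ∀ ω, 0 < X ω ↔ 0 < Y ω) :
    indPos X = indPos Y := by
  simp only [indPos, h]

theorem indPos_pos_iff {Ω : Type*} {X : Ω → ℝ} {ω : Ω} : 0 < indPos X ω ↔ 0 < X ω := by
  rcases lt_or_ge 0 (X ω) with h | h
  · simp [indPos_of_pos h, h]
  · simp [indPos_of_nonpos h, h.not_gt]

theorem indPos_mem_Bb {Ω : Type*} [MeasurableSpace Ω] {X : Ω → ℝ} (hX : X ∈ Bb Ω) :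
    indPos X ∈ Bb Ω := by
  refine ⟨measurable_indPos hX.1, 1, fun ω => ?_⟩
  rcases lt_or_ge 0 (X ω) with h | h
  · simp [indPos_of_pos h]
  · simp [indPos_of_nonpos h]

theorem add_mul_mem_Bb {Ω : Type*} [MeasurableSpace Ω] {X Y : Ω → ℝ} (hX : X ∈ Bb Ω)
    (hY : Y ∈ Bb Ω) (m : ℝ) : (fun ω => X ω + m * Y ω) ∈ Bb Ω := by
  obtain ⟨hXm, M, hM⟩ := hX
  obtain ⟨hYm, N, hN⟩ := hY
  refine ⟨hXm.add (hYm.const_mul m), M + |m| * N, fun ω => (abs_add_le _ _).trans ?_⟩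
  rw [abs_mul]
  exact add_le_add (hM ω) (mul_le_mul_of_nonneg_left (hN ω) (abs_nonneg m))

theorem zero_mem_Bb {Ω : Type*} [MeasurableSpace Ω] : (fun _ => 0 : Ω → ℝ) ∈ Bb Ω :=
  ⟨measurable_const, 0, by simp⟩

theorem inf_mem_Bb {Ω : Type*} [MeasurableSpace Ω] {X Y : Ω → ℝ} (hX : X ∈ Bb Ω)
    (hY : Y ∈ Bb Ω) : X ⊓ Y ∈ Bb Ω := by
  obtain ⟨hXm, M, hM⟩ := hX
  obtain ⟨hYm, N, hN⟩ := hY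
  exact ⟨hXm.inf hYm, max M N, fun ω =>
    abs_min_le_max_abs_abs.trans (max_le_max (hM ω) (hN ω))⟩

theorem sup_mem_Bb {Ω : Type*} [MeasurableSpace Ω] {X Y : Ω → ℝ} (hX : X ∈ Bb Ω)
    (hY : Y ∈ Bb Ω) : X ⊔ Y ∈ Bb Ω := by
  obtain ⟨hXm, M, hM⟩ := hX
  obtain ⟨hYm, N, hN⟩ := hY
  exact ⟨hXm.sup hYm, max M N, fun ω =>
    abs_max_le_max_abs_abs.trans (max_le_max (hM ω) (hN ω))⟩

/-- A submodular default risk measure depends only on the positive part. -/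
theorem IsDefaultRiskMeasure.eq_sup_zero {Ω : Type*} [MeasurableSpace Ω] {ρ : (Ω → ℝ) → ℝ}
    (hρ : IsDefaultRiskMeasure (Bb Ω) ρ)
    (hsubmod : ∀ X ∈ Bb Ω, ∀ Y ∈ Bb Ω, ρ (X ⊓ Y) + ρ (X ⊔ Y) ≤ ρ X + ρ Y)
    {X : Ω → ℝ} (hX : X ∈ Bb Ω) : ρ X = ρ (X ⊔ fun _ => 0) := by
  obtain ⟨hIcc, hmono, hzero, -⟩ := hρ
  refine le_antisymm (hmono _ hX _ (sup_mem_Bb hX zero_mem_Bb) fun ω => le_sup_left) ?_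
  linarith [hsubmod X hX _ zero_mem_Bb, (hIcc _ (inf_mem_Bb hX zero_mem_Bb)).1]

/-- An illiquidity invariant default risk measure evaluates a nonnegative position at the
indicator of its default set. -/
theorem IsDefaultRiskMeasure.eq_indPos_of_nonneg {Ω : Type*} [MeasurableSpace Ω]
    {ρ : (Ω → ℝ) → ℝ} (hρ : IsDefaultRiskMeasure (Bb Ω) ρ)
    (hill : ∀ m : ℝ, 0 < m → ∀ X ∈ Bb Ω, (∀ ω, 0 ≤ X ω) →
      ρ X = ρ (fun ω => X ω + m * indPos X ω))
    {X : Ω → ℝ} (hX : X ∈ Bb Ω) (hX0 : ∀ ω, 0 ≤ X ω) : ρ X = ρ (indPos X) := by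
  have hmono := hρ.2.1
  have hI := indPos_mem_Bb hX
  have hII : indPos (indPos X) = indPos X := indPos_congr fun _ => indPos_pos_iff
  obtain ⟨M, hM⟩ := hX.2
  apply le_antisymm
  · rw [hill (max M 1) (by positivity) _ hI (indPos_nonneg X), hII]
    refine hmono _ hX _ (add_mul_mem_Bb hI hI _) fun ω => ?_
    rcases lt_or_ge 0 (X ω) with h | h
    · rw [indPos_of_pos h]
      linarith [le_abs_self (X ω), hM ω, le_max_left M 1]
    · simpa [indPos_of_nonpos h] using h
  · rw [hill 1 one_pos X hX hX0]
    exact hmono _ hI _ (add_mul_mem_Bb hX hI 1) fun ω => by linarith [hX0 ω]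

/-- a submodular default risk measure is illiquidity invariant iff
`ρ(X) = ρ(𝟙_{X>0})` for all `X ∈ Bb Ω`. -/
theorem submodular_illiquidity_iff_capacity {Ω : Type*} [MeasurableSpace Ω]
    (ρ : (Ω → ℝ) → ℝ) (hρ : IsDefaultRiskMeasure (Bb Ω) ρ)
    (hsubmod : ∀ X ∈ Bb Ω, ∀ Y ∈ Bb Ω, ρ (X ⊓ Y) + ρ (X ⊔ Y) ≤ ρ X + ρ Y) :
    (∀ m : ℝ, 0 < m → ∀ X ∈ Bb Ω, (∀ ω, 0 ≤ X ω) →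
        ρ X = ρ (fun ω => X ω + m * indPos X ω)) ↔
    (∀ X ∈ Bb Ω, ρ X = ρ (indPos X)) := by
  constructor
  · intro hill X hX
    rw [hρ.eq_sup_zero hsubmod hX, hρ.eq_indPos_of_nonneg hill (sup_mem_Bb hX zero_mem_Bb)
      fun ω => le_sup_right]
    congr 1
    exact indPos_congr fun ω => by simp
  · intro h m hm X hX _
    rw [h X hX, h _ (add_mul_mem_Bb hX (indPos_mem_Bb hX) m)]
    congr 1
    refine indPos_congr fun ω => ?_
    rcases lt_or_ge 0 (X ω) with hω | hω
    · simp only [indPos_of_pos hω, hω, true_iff]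
      positivity
    · simp [indPos_of_nonpos hω]
end

section
/- Let ρ : B_b → [0,1] be a default risk measure with ρ(X) = ρ(𝟙_{X>0}) for all X ∈ B_b, and define the capacity c(A) := ρ(𝟙_A) for A ∈ ℱ. Then the following are equivalent: (i) for every sequence (X_n) ⊂ B_b with X_n ↘ 0 pointwise and every ε > 0, lim_{n→∞} ρ(X_n − ε) = 0; (ii) for every sequence (A_n) ⊂ ℱ with A_{n+1} ⊆ A_n for all n and ⋂_{n∈ℕ} A_n = ∅, lim_{n→∞} ρ(𝟙_{A_n}) = 0; (iii) lim_{n→∞} ∫ X_n dc = 0 for every sequence (X_n) ⊂ B_b with X_n ↘ 0 pointwise, where the Choquet integral of X ≥ 0 is ∫ X dc := ∫_0^∞ c({X > s}) ds. -/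
open MeasureTheory Filter Topology

/-- The capacity induced by a default risk measure: `c(A) = ρ(𝟙_A)`. -/
noncomputable def cap {Ω : Type*} (ρ : (Ω → ℝ) → ℝ) (A : Set Ω) : ℝ :=
  ρ (Set.indicator A (fun _ => 1))

/-- The Choquet integral of a nonnegative `X` with respect to the capacity
induced by `ρ`: `∫ X dc = ∫_0^∞ c({X > s}) ds`. -/
noncomputable def choquetNonneg {Ω : Type*} (ρ : (Ω → ℝ) → ℝ) (X : Ω → ℝ) : ℝ :=
  ∫ s in Set.Ioi (0 : ℝ), cap ρ {ω | s < X ω}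

section

variable {Ω : Type*}

lemma indicator_mem_Bb [MeasurableSpace Ω] {A : Set Ω} (hA : MeasurableSet A) :
    Set.indicator A (fun _ => (1 : ℝ)) ∈ Bb Ω := by
  refine ⟨measurable_const.indicator hA, 1, fun ω => ?_⟩
  by_cases h : ω ∈ A <;> simp [h]

lemma sub_const_mem_Bb [MeasurableSpace Ω] {X : Ω → ℝ} (hX : X ∈ Bb Ω) (m : ℝ) :
    (fun ω => X ω - m) ∈ Bb Ω := by
  obtain ⟨hm, M, hM⟩ := hX
  exact ⟨hm.sub_const m, M + |m|, fun ω => (abs_sub _ _).trans (by linarith [hM ω])⟩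

lemma setOf_lt_indicator_one (A : Set Ω) {s : ℝ} (h0 : 0 ≤ s) (h1 : s < 1) :
    {ω | s < Set.indicator A (fun _ => (1 : ℝ)) ω} = A := by
  ext ω
  by_cases h : ω ∈ A <;> simp [h, h0, h1]

lemma setOf_lt_indicator_one_of_one_le (A : Set Ω) {s : ℝ} (h1 : 1 ≤ s) :
    {ω | s < Set.indicator A (fun _ => (1 : ℝ)) ω} = ∅ := by
  ext ω
  by_cases h : ω ∈ A <;> simp [h] <;> linarith

lemma tendsto_indicator_of_antitone {A : ℕ → Set Ω} (hA : ∀ n, A (n + 1) ⊆ A n)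
    (hA' : (⋂ n, A n) = ∅) (ω : Ω) :
    Tendsto (fun n => Set.indicator (A n) (fun _ => (1 : ℝ)) ω) atTop (𝓝 0) := by
  have h := ((antitone_nat_of_succ_le hA).tendsto_indicator A (fun _ : Ω => (1 : ℝ)) ω).mono_right
    (pure_le_nhds _)
  rwa [hA', Set.indicator_empty] at h

lemma iInter_setOf_lt_eq_empty {X : ℕ → Ω → ℝ}
    (hX : ∀ ω, Tendsto (fun n => X n ω) atTop (𝓝 0)) {s : ℝ} (hs : 0 < s) :
    (⋂ n, {ω | s < X n ω}) = ∅ := by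
  refine Set.eq_empty_of_forall_notMem fun ω hω => ?_
  obtain ⟨n, hn⟩ := ((hX ω).eventually_lt_const hs).exists
  exact lt_asymm hn (Set.mem_iInter.1 hω n)

lemma cap_empty {ρ : (Ω → ℝ) → ℝ} (h0 : ρ (fun _ => 0) = 0) : cap ρ ∅ = 0 := by
  simpa [cap] using h0

lemma IsDefaultRiskMeasure.cap_mono [MeasurableSpace Ω] {ρ : (Ω → ℝ) → ℝ}
    (hρ : IsDefaultRiskMeasure (Bb Ω) ρ) {A B : Set Ω} (hA : MeasurableSet A)
    (hB : MeasurableSet B) (h : A ⊆ B) : cap ρ A ≤ cap ρ B :=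
  hρ.2.1 _ (indicator_mem_Bb hA) _ (indicator_mem_Bb hB)
    (Set.indicator_le_indicator_of_subset h fun _ => zero_le_one)

lemma choquetNonneg_indicator {ρ : (Ω → ℝ) → ℝ} (h0 : ρ (fun _ => 0) = 0) (A : Set Ω) :
    choquetNonneg ρ (Set.indicator A (fun _ => 1)) = cap ρ A := by
  have h : ∀ s ∈ Set.Ioi (0 : ℝ), cap ρ {ω | s < Set.indicator A (fun _ => (1 : ℝ)) ω} =
      Set.indicator (Set.Iio 1) (fun _ => cap ρ A) s := by
    intro s hs
    rcases lt_or_ge s 1 with h1 | h1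
    · rw [setOf_lt_indicator_one A (le_of_lt hs) h1, Set.indicator_of_mem (Set.mem_Iio.2 h1)]
    · rw [setOf_lt_indicator_one_of_one_le A h1, cap_empty h0,
        Set.indicator_of_notMem (by simpa using h1)]
  rw [choquetNonneg, setIntegral_congr_fun measurableSet_Ioi h,
    setIntegral_indicator measurableSet_Iio, Set.Ioi_inter_Iio]
  simp

lemma tendsto_choquetNonneg [MeasurableSpace Ω] {ρ : (Ω → ℝ) → ℝ}
    (hρ : IsDefaultRiskMeasure (Bb Ω) ρ) {X : ℕ → Ω → ℝ} (hX : ∀ n, X n ∈ Bb Ω)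
    (hanti : ∀ n ω, X (n + 1) ω ≤ X n ω)
    (hcap : ∀ s : ℝ, 0 < s → Tendsto (fun n => cap ρ {ω | s < X n ω}) atTop (𝓝 0)) :
    Tendsto (fun n => choquetNonneg ρ (X n)) atTop (𝓝 0) := by
  obtain ⟨-, M, hM⟩ := hX 0
  have hmeas : ∀ n (s : ℝ), MeasurableSet {ω | s < X n ω} := fun n s =>
    measurableSet_lt measurable_const (hX n).1
  have hle : ∀ n ω, X n ω ≤ M := fun n ω =>
    (antitone_nat_of_succ_le (f := fun n => X n ω) (fun n => hanti n ω) (Nat.zero_le n)).trans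
      ((le_abs_self _).trans (hM ω))
  have hlim := tendsto_integral_of_dominated_convergence
    (μ := volume.restrict (Set.Ioi (0 : ℝ))) (F := fun n s => cap ρ {ω | s < X n ω})
    (f := fun _ => 0) (Set.indicator (Set.Iio M) fun _ => (1 : ℝ)) ?_ ?_ ?_ ?_
  · simpa [choquetNonneg] using hlim
  · intro n
    have : Antitone fun s : ℝ => cap ρ {ω | s < X n ω} := fun s t hst =>
      hρ.cap_mono (hmeas n t) (hmeas n s) fun ω hω => lt_of_le_of_lt hst hω
    exact this.measurable.aestronglyMeasurable
  · rw [integrable_indicator_iff measurableSet_Iio, IntegrableOn,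
      Measure.restrict_restrict measurableSet_Iio, Set.inter_comm, Set.Ioi_inter_Iio]
    exact integrable_const _
  · refine fun n => ae_of_all _ fun s => ?_
    rcases lt_or_ge s M with h | h
    · obtain ⟨h0, h1⟩ := hρ.1 _ (indicator_mem_Bb (hmeas n s))
      rw [Set.indicator_of_mem (Set.mem_Iio.2 h), Real.norm_eq_abs, cap, abs_of_nonneg h0]
      exact h1
    · have he : {ω | s < X n ω} = ∅ :=
        Set.eq_empty_of_forall_notMem fun ω hω => (lt_of_lt_of_le hω ((hle n ω).trans h)).false
      simp [he, cap_empty hρ.2.2.1, h]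
  · exact (ae_restrict_iff' measurableSet_Ioi).2 (ae_of_all _ fun s hs => hcap s hs)

end

/-- for a default risk measure `ρ` with `ρ(X) = ρ(𝟙_{X>0})`, the
following are equivalent: (i) `ρ(X_n − ε) → 0` for all `X_n ↘ 0` and `ε > 0`;
(ii) `c(A_n) → 0` for decreasing measurable sets with empty intersection;
(iii) `∫ X_n dc → 0` for all `X_n ↘ 0`. -/
theorem continuity_from_above_equiv {Ω : Type*} [MeasurableSpace Ω]
    (ρ : (Ω → ℝ) → ℝ) (hρ : IsDefaultRiskMeasure (Bb Ω) ρ)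
    (hrep : ∀ X ∈ Bb Ω, ρ X = ρ (Set.indicator {ω | 0 < X ω} (fun _ => 1))) :
    ((∀ Xn : ℕ → Ω → ℝ, (∀ n, Xn n ∈ Bb Ω) →
        (∀ n ω, Xn (n + 1) ω ≤ Xn n ω) → (∀ n ω, 0 ≤ Xn n ω) →
        (∀ ω, Tendsto (fun n => Xn n ω) atTop (𝓝 0)) →
        ∀ ε : ℝ, 0 < ε →
          Tendsto (fun n => ρ (fun ω => Xn n ω - ε)) atTop (𝓝 0)) ↔
      (∀ A : ℕ → Set Ω, (∀ n, MeasurableSet (A n)) →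
        (∀ n, A (n + 1) ⊆ A n) → (⋂ n, A n) = ∅ →
        Tendsto (fun n => ρ (Set.indicator (A n) (fun _ => 1))) atTop (𝓝 0))) ∧
    ((∀ A : ℕ → Set Ω, (∀ n, MeasurableSet (A n)) →
        (∀ n, A (n + 1) ⊆ A n) → (⋂ n, A n) = ∅ →
        Tendsto (fun n => ρ (Set.indicator (A n) (fun _ => 1))) atTop (𝓝 0)) ↔
      (∀ Xn : ℕ → Ω → ℝ, (∀ n, Xn n ∈ Bb Ω) →
        (∀ n ω, Xn (n + 1) ω ≤ Xn n ω) → (∀ n ω, 0 ≤ Xn n ω) →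
        (∀ ω, Tendsto (fun n => Xn n ω) atTop (𝓝 0)) →
        Tendsto (fun n => choquetNonneg ρ (Xn n)) atTop (𝓝 0))) := by
  refine ⟨⟨fun h A hA hsub hA' => ?_, fun h X hX hanti _ hlim ε hε => ?_⟩,
    fun h X hX hanti _ hlim => ?_, fun h A hA hsub hA' => ?_⟩
  · refine (h _ (fun n => indicator_mem_Bb (hA n))
      (fun n => Set.indicator_le_indicator_of_subset (hsub n) fun _ => zero_le_one)
      (fun n => Set.indicator_nonneg fun _ _ => zero_le_one)
      (tendsto_indicator_of_antitone hsub hA') (1 / 2) (by norm_num)).congr fun n => ?_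
    rw [hrep _ (sub_const_mem_Bb (indicator_mem_Bb (hA n)) _)]
    simp only [sub_pos]
    rw [setOf_lt_indicator_one _ (by norm_num) (by norm_num)]
  · refine (h (fun n => {ω | ε < X n ω}) (fun n => measurableSet_lt measurable_const (hX n).1)
      (fun n ω hω => lt_of_lt_of_le hω (hanti n ω))
      (iInter_setOf_lt_eq_empty hlim hε)).congr fun n => ?_
    rw [hrep _ (sub_const_mem_Bb (hX n) ε)]
    simp only [sub_pos]
  · exact tendsto_choquetNonneg hρ hX hanti fun s hs =>
      h _ (fun n => measurableSet_lt measurable_const (hX n).1)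
        (fun n ω hω => lt_of_lt_of_le hω (hanti n ω)) (iInter_setOf_lt_eq_empty hlim hs)
  · exact (h _ (fun n => indicator_mem_Bb (hA n))
      (fun n => Set.indicator_le_indicator_of_subset (hsub n) fun _ => zero_le_one)
      (fun n => Set.indicator_nonneg fun _ _ => zero_le_one)
      (tendsto_indicator_of_antitone hsub hA')).congr fun n =>
        choquetNonneg_indicator hρ.2.2.1 (A n)
end

section
/- Let ℙ be a probability measure on ℱ, let C ⊆ B_b contain all constant functions and satisfy 𝟙_{X>0} ∈ C for all X ∈ C, and let ρ : C → [0,1] be a default risk measure. Then the following are equivalent: (i) ρ is law-invariant with respect to ℙ and ρ(X) = ρ(𝟙_{X>0}) for all X ∈ C; (ii) there exists a distortion function T : [0,1] → [0,1] (i.e., T(0) = 0 and T(1) = 1) such that ρ(X) = T(ℙ(X > 0)) for all X ∈ C. -/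
open MeasureTheory Filter Topology

/-- The law of the indicator of a measurable set depends only on the probability of that set. -/
theorem map_indicator_one_eq {Ω : Type*} [MeasurableSpace Ω] (P : Measure Ω)
    [IsProbabilityMeasure P] {A B : Set Ω} (hA : MeasurableSet A) (hB : MeasurableSet B)
    (h : P A = P B) :
    Measure.map (A.indicator fun _ => (1 : ℝ)) P = Measure.map (B.indicator fun _ => (1 : ℝ)) P := by
  classical
  ext s hs
  rw [Measure.map_apply (measurable_const.indicator hA) hs,
    Measure.map_apply (measurable_const.indicator hB) hs]
  have hc : P Aᶜ = P Bᶜ := by rw [prob_compl_eq_one_sub hA, prob_compl_eq_one_sub hB, h]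
  by_cases h1 : (1 : ℝ) ∈ s <;> by_cases h0 : (0 : ℝ) ∈ s <;>
    simp [Set.indicator_const_preimage_eq_union, h1, h0, h, hc]

/-- The default set of a random variable is also the default set of its indicator. -/
theorem setOf_indicator_one_pos {Ω : Type*} (A : Set Ω) :
    {ω | 0 < A.indicator (fun _ => (1 : ℝ)) ω} = A := by
  ext ω
  by_cases h : ω ∈ A <;> simp [h]

/-- a default risk measure on `C` is law-invariant and determined by
the default set iff it is a distorted PD for some distortion function `T`. -/
theorem lawInvariant_iff_distortedPD {Ω : Type*} [MeasurableSpace Ω]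
    (P : Measure Ω) [IsProbabilityMeasure P]
    (C : Set (Ω → ℝ)) (hC : C ⊆ Bb Ω)
    (hconst : ∀ m : ℝ, (fun _ => m) ∈ C)
    (hind : ∀ X ∈ C, Set.indicator {ω | 0 < X ω} (fun _ => (1 : ℝ)) ∈ C)
    (ρ : (Ω → ℝ) → ℝ) (hρ : IsDefaultRiskMeasure C ρ) :
    ((∀ X ∈ C, ∀ Y ∈ C, Measure.map X P = Measure.map Y P → ρ X = ρ Y) ∧
      (∀ X ∈ C, ρ X = ρ (Set.indicator {ω | 0 < X ω} (fun _ => 1)))) ↔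
    (∃ T : ℝ → ℝ, T 0 = 0 ∧ T 1 = 1 ∧
      Set.MapsTo T (Set.Icc 0 1) (Set.Icc 0 1) ∧
      ∀ X ∈ C, ρ X = T ((P {ω | 0 < X ω}).toReal)) := by
  obtain ⟨hrange, -, hzero, hone⟩ := hρ
  have hpos : ∀ X ∈ C, MeasurableSet {ω | 0 < X ω} := fun X hX =>
    measurableSet_lt measurable_const (hC hX).1
  constructor
  · rintro ⟨hlaw, hdef⟩
    let p : C → ℝ := fun X => (P {ω | 0 < X.1 ω}).toReal
    let r : C → ℝ := fun X => ρ X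
    have hfac : Function.FactorsThrough r p := by
      intro X Y hXY
      have hP : P {ω | 0 < X.1 ω} = P {ω | 0 < Y.1 ω} :=
        (ENNReal.toReal_eq_toReal_iff' (measure_ne_top _ _) (measure_ne_top _ _)).1 hXY
      change ρ X = ρ Y
      rw [hdef X X.2, hdef Y Y.2]
      exact hlaw _ (hind X X.2) _ (hind Y Y.2)
        (map_indicator_one_eq P (hpos X X.2) (hpos Y Y.2) hP)
    have hT : ∀ X ∈ C, ρ X = Function.extend p r 0 (P {ω | 0 < X ω}).toReal := fun X hX =>
      (hfac.extend_apply 0 ⟨X, hX⟩).symm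
    refine ⟨Function.extend p r 0, ?_, ?_, ?_, hT⟩
    · simpa [hzero] using (hT _ (hconst 0)).symm
    · simpa [hone 1 one_pos] using (hT _ (hconst 1)).symm
    · intro x _
      by_cases hx : ∃ X, p X = x
      · obtain ⟨X, rfl⟩ := hx
        rw [hfac.extend_apply]
        exact hrange X X.2
      · rw [Function.extend_apply' _ _ _ hx]
        exact ⟨le_rfl, zero_le_one⟩
  · rintro ⟨T, -, -, -, hT⟩
    refine ⟨fun X hX Y hY hXY => ?_, fun X hX => ?_⟩
    · have hP : P {ω | 0 < X ω} = P {ω | 0 < Y ω} := by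
        have h := congrArg (fun μ => μ (Set.Ioi (0 : ℝ))) hXY
        simp only [Measure.map_apply (hC hX).1 measurableSet_Ioi,
          Measure.map_apply (hC hY).1 measurableSet_Ioi] at h
        exact h
      rw [hT X hX, hT Y hY, hP]
    · rw [hT X hX, hT _ (hind X hX), setOf_indicator_one_pos]
end

section
/- Let (Ω, ℱ, ℙ) be a probability space, T : [0,1] → [0,1] with T(0) = 0 and T(1) = 1, and define c(A) := T(ℙ(A)) for A ∈ ℱ. If T is concave, then c is 2-alternating, i.e., c(A ∪ B) + c(A ∩ B) ≤ c(A) + c(B) for all A, B ∈ ℱ. -/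
open MeasureTheory Filter Topology

/-- A concave function is larger in sum at inner points than at outer points with the same sum. -/
theorem ConcaveOn.add_le_add_of_add_eq {s : Set ℝ} {f : ℝ → ℝ} (hf : ConcaveOn ℝ s f)
    {a x y b : ℝ} (ha : a ∈ s) (hb : b ∈ s) (hax : a ≤ x) (hay : a ≤ y) (h : x + y = b + a) :
    f b + f a ≤ f x + f y := by
  have hx : x ∈ segment ℝ a b := by
    rw [segment_eq_Icc (by linarith)]
    exact ⟨hax, by linarith⟩
  obtain ⟨u, v, hu, hv, huv, rfl⟩ := hx
  have hy : y = v • a + u • b := by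
    simp only [smul_eq_mul] at h ⊢
    linear_combination h - (a + b) * huv
  have h₁ := hf.2 ha hb hu hv huv
  have h₂ := hf.2 ha hb hv hu (by rwa [add_comm])
  rw [← hy] at h₂
  simp only [smul_eq_mul] at h₁ h₂ ⊢
  linear_combination h₁ + h₂ - (f a + f b) * huv

/-- if `T` is a concave distortion function, then the distorted
probability `c(A) = T(ℙ(A))` is 2-alternating. -/
theorem concave_distortion_two_alternating {Ω : Type*} [MeasurableSpace Ω]
    (P : Measure Ω) [IsProbabilityMeasure P]
    (T : ℝ → ℝ) (hT0 : T 0 = 0) (hT1 : T 1 = 1)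
    (hconc : ConcaveOn ℝ (Set.Icc 0 1) T) :
    ∀ A B : Set Ω, MeasurableSet A → MeasurableSet B →
      T ((P (A ∪ B)).toReal) + T ((P (A ∩ B)).toReal)
        ≤ T ((P A).toReal) + T ((P B).toReal) := by
  intro A B _ hB
  have hmem (S : Set Ω) : (P S).toReal ∈ Set.Icc (0 : ℝ) 1 :=
    ⟨measureReal_nonneg, measureReal_le_one⟩
  exact hconc.add_le_add_of_add_eq (hmem _) (hmem _)
    (measureReal_mono Set.inter_subset_left) (measureReal_mono Set.inter_subset_right)
    (measureReal_union_add_inter hB).symm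
end
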